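/- arXiv:2601.03998 — 2 statements merged into one kernel-verified Lean document; each statement's English description precedes it below -/
import Mathlib

section
/- For |q|<1, one has ∑_{n≥1} (1/q;q²)_{n+1}·(-1)^n·q^{2n+1}/(-q²;q²)_n = ∑_{n≥1} (-q;q²)_n·q^{n²}/(-q²;q²)_n² − q. -/
open scoped BigOperators

/-- The finite q-Pochhammer symbol `(a;q)_n = ∏_{j=0}^{n-1} (1 - a q^j)`. -/
noncomputable def qPoch (a q : ℂ) (n : ℕ) : ℂ := ∏ j ∈ Finset.range n, (1 - a * q ^ j)

open Filter Topology

lemma qPoch_last (a q : ℂ) (n : ℕ) : qPoch a q (n + 1) = qPoch a q n * (1 - a * q ^ n) := by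
  simp [qPoch, Finset.prod_range_succ]

lemma qPoch_first (a q : ℂ) (n : ℕ) : qPoch a q (n + 1) = (1 - a) * qPoch (a * q) q n := by
  simp only [qPoch, Finset.prod_range_succ', pow_zero, mul_one]
  rw [mul_comm]
  congr 1
  apply Finset.prod_congr rfl
  intro j _
  ring

lemma qPoch_zero' (a q : ℂ) : qPoch a q 0 = 1 := by simp [qPoch]

lemma one_add_pow_ne (q : ℂ) (hq : ‖q‖ < 1) (k : ℕ) : 1 + (q ^ 2) ^ (k + 1) ≠ 0 := by
  intro h
  have h1 : (q ^ 2) ^ (k + 1) = -1 := by linear_combination h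
  have h2 : ‖(q ^ 2) ^ (k + 1)‖ < 1 := by
    rw [← pow_mul, norm_pow]
    exact pow_lt_one₀ (norm_nonneg _) hq (by omega)
  rw [h1] at h2
  simp at h2

lemma qPoch_ne (q : ℂ) (hq : ‖q‖ < 1) (k n : ℕ) :
    qPoch (-(q ^ 2) ^ (k + 1)) (q ^ 2) n ≠ 0 := by
  rw [qPoch, Finset.prod_ne_zero_iff]
  intro j _
  have := one_add_pow_ne q hq (k + j)
  intro h
  apply this
  rw [← h]
  ring

noncomputable def fT (q : ℂ) (k n : ℕ) : ℂ :=
  qPoch q (q ^ 2) n * (-(q ^ 2) ^ (k + 1)) ^ n / qPoch (-(q ^ 2) ^ (k + 1)) (q ^ 2) n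

noncomputable def aT (q : ℂ) (n : ℕ) : ℂ :=
  qPoch (-q) (q ^ 2) n * q ^ (n ^ 2) / (qPoch (-q ^ 2) (q ^ 2) n) ^ 2

lemma fT_succ (q : ℂ) (hq : ‖q‖ < 1) (k n : ℕ) :
    fT q k (n + 1) = ((1 - q * (q ^ 2) ^ n) * (-(q ^ 2) ^ (k + 1)) / (1 + (q ^ 2) ^ (k + n + 1)))
      * fT q k n := by
  have h1 := one_add_pow_ne q hq (k + n)
  have h2 := qPoch_ne q hq k n
  have h3 : (1 - -(q ^ 2) ^ (k + 1) * (q ^ 2) ^ n) = 1 + (q ^ 2) ^ (k + n + 1) := by ring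
  simp only [fT, qPoch_last, h3]
  rw [pow_succ (-(q ^ 2) ^ (k + 1)) n]
  field_simp

lemma aT_succ (q : ℂ) (hq : ‖q‖ < 1) (n : ℕ) :
    aT q (n + 1) = ((1 + q * (q ^ 2) ^ n) * (q * (q ^ 2) ^ n) / (1 + (q ^ 2) ^ (n + 1)) ^ 2)
      * aT q n := by
  have h1 := one_add_pow_ne q hq n
  have h2 := qPoch_ne q hq 0 n
  simp only [zero_add, pow_one] at h2
  have h3 : (1 - -q ^ 2 * (q ^ 2) ^ n) = 1 + (q ^ 2) ^ (n + 1) := by ring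
  have h4 : q ^ ((n + 1) ^ 2) = q ^ (n ^ 2) * (q * (q ^ 2) ^ n) := by ring
  simp only [aT, qPoch_last, h3, h4]
  field_simp
  ring

lemma tendsto_p (q : ℂ) (hq : ‖q‖ < 1) : Tendsto (fun n : ℕ => (q ^ 2) ^ n) atTop (𝓝 0) := by
  apply tendsto_pow_atTop_nhds_zero_of_norm_lt_one
  rw [norm_pow]
  exact pow_lt_one₀ (norm_nonneg _) hq (by omega)

lemma summable_of_ratio (f c : ℕ → ℂ) (l : ℂ) (hl : ‖l‖ < 1) (hc : Tendsto c atTop (𝓝 l))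
    (h : ∀ n, f (n + 1) = c n * f n) : Summable f := by
  obtain ⟨r, hr1, hr2⟩ := exists_between hl
  apply summable_of_ratio_norm_eventually_le hr2
  filter_upwards [hc.norm.eventually_lt_const hr1] with n hn
  rw [h, norm_mul]
  gcongr

lemma fT_summable (q : ℂ) (hq : ‖q‖ < 1) (k : ℕ) : Summable (fT q k) := by
  have hp := tendsto_p q hq
  have hp2 : Tendsto (fun n : ℕ => (q ^ 2) ^ (k + n + 1)) atTop (𝓝 0) := by
    have := hp.comp (tendsto_add_atTop_nat (k + 1))
    refine this.congr fun n => ?_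
    simp only [Function.comp]
    congr 1
    ring
  refine summable_of_ratio _ _ ((1 - q * 0) * (-(q ^ 2) ^ (k + 1)) / (1 + 0)) ?_ ?_ (fT_succ q hq k)
  · simp only [mul_zero, sub_zero, one_mul, add_zero, div_one, norm_neg]
    rw [← pow_mul, norm_pow]
    exact pow_lt_one₀ (norm_nonneg _) hq (by omega)
  · exact (((hp.const_mul q).const_sub 1).mul_const _).div (hp2.const_add 1) (by simp)

lemma aT_summable (q : ℂ) (hq : ‖q‖ < 1) : Summable (aT q) := by
  have hp := tendsto_p q hq
  have hp2 := hp.comp (tendsto_add_atTop_nat 1)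
  refine summable_of_ratio _ _ ((1 + q * 0) * (q * 0) / (1 + 0) ^ 2) ?_ ?_ (aT_succ q hq)
  · simp
  · exact (((hp.const_mul q).const_add 1).mul (hp.const_mul q)).div
      ((hp2.const_add 1).pow 2) (by simp)

lemma fT_rec (q : ℂ) (hq : ‖q‖ < 1) (k n : ℕ) :
    fT q k (n + 1) = (q ^ 2) ^ (k + 1) * (q + (q ^ 2) ^ (k + 1)) / (1 + (q ^ 2) ^ (k + 1)) *
      fT q (k + 1) n - (q ^ 2) ^ (k + 1) * fT q k n := by
  have h1 := one_add_pow_ne q hq (k + n)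
  have h0 := one_add_pow_ne q hq k
  have h2 := qPoch_ne q hq k n
  have h5 := qPoch_ne q hq (k + 1) n
  have h6 : qPoch (-(q ^ 2) ^ (k + 1)) (q ^ 2) n * (1 + (q ^ 2) ^ (k + n + 1)) =
      (1 + (q ^ 2) ^ (k + 1)) * qPoch (-(q ^ 2) ^ (k + 1 + 1)) (q ^ 2) n := by
    have e := (qPoch_last (-(q ^ 2) ^ (k + 1)) (q ^ 2) n).symm.trans
      (qPoch_first (-(q ^ 2) ^ (k + 1)) (q ^ 2) n)
    have e1 : -(q ^ 2) ^ (k + 1) * q ^ 2 = -(q ^ 2) ^ (k + 1 + 1) := by ring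
    rw [e1] at e
    linear_combination e
  have h7 : fT q (k + 1) n = (q ^ 2) ^ n * (1 + (q ^ 2) ^ (k + 1)) / (1 + (q ^ 2) ^ (k + n + 1))
      * fT q k n := by
    have e2 : (-(q ^ 2) ^ (k + 1 + 1)) ^ n = (-(q ^ 2) ^ (k + 1)) ^ n * (q ^ 2) ^ n := by
      rw [← mul_pow]; congr 1; ring
    simp only [fT, e2]
    rw [div_mul_div_comm, div_eq_div_iff h5 (mul_ne_zero h1 h2)]
    linear_combination (qPoch q (q ^ 2) n * (-(q ^ 2) ^ (k + 1)) ^ n * (q ^ 2) ^ n) * h6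
  rw [fT_succ q hq, h7]
  have h8 : (q ^ 2) ^ (k + n + 1) = (q ^ 2) ^ (k + 1) * (q ^ 2) ^ n := by ring
  rw [h8] at h1 ⊢
  generalize (q ^ 2) ^ (k + 1) = x at *
  generalize (q ^ 2) ^ n = y at *
  have h1' : 1 + y * x ≠ 0 := by rwa [mul_comm]
  field_simp
  ring

noncomputable def FT (q : ℂ) (k : ℕ) : ℂ := ∑' n, fT q k n

lemma FT_rec (q : ℂ) (hq : ‖q‖ < 1) (k : ℕ) :
    (1 + (q ^ 2) ^ (k + 1)) * FT q k = 1 +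
      (q ^ 2) ^ (k + 1) * (q + (q ^ 2) ^ (k + 1)) / (1 + (q ^ 2) ^ (k + 1)) * FT q (k + 1) := by
  have hs := fT_summable q hq
  have h0 : fT q k 0 = 1 := by simp [fT, qPoch_zero']
  have h := (hs k).tsum_eq_zero_add
  simp only [fT_rec q hq k] at h
  rw [Summable.tsum_sub ((hs (k+1)).mul_left _) ((hs k).mul_left _), tsum_mul_left, tsum_mul_left,
    h0] at h
  simp only [FT]
  linear_combination h

lemma FT_bound (q : ℂ) (hq : ‖q‖ < 1) : ∀ᶠ k in atTop, ‖FT q k‖ ≤ 2 := by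
  have hp := (tendsto_p q hq).norm
  rw [norm_zero] at hp
  filter_upwards [hp.eventually_lt_const (show (0:ℝ) < 1 / 5 by norm_num)] with k hk
  have hle : ∀ m : ℕ, ‖(q ^ 2) ^ m‖ ≤ 1 := fun m => by
    rw [← pow_mul, norm_pow]
    exact pow_le_one₀ (norm_nonneg _) hq.le
  have hk2 : ∀ m : ℕ, ‖(q ^ 2) ^ (k + m)‖ ≤ 1 / 5 := fun m => by
    rw [pow_add, norm_mul]
    nlinarith [hle m, norm_nonneg ((q ^ 2) ^ m), norm_nonneg ((q ^ 2) ^ k)]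
  have hb : ∀ n, ‖fT q k n‖ ≤ (1 / 2 : ℝ) ^ n := by
    intro n
    induction n with
    | zero => simp [fT, qPoch_zero']
    | succ n ih =>
      rw [fT_succ q hq, norm_mul, pow_succ (1 / 2 : ℝ) n, mul_comm]
      refine mul_le_mul ih ?_ (norm_nonneg _) (by positivity)
      rw [norm_div, norm_mul, norm_neg]
      have a1 : ‖1 - q * (q ^ 2) ^ n‖ ≤ 2 := by
        refine (norm_sub_le _ _).trans ?_
        rw [norm_mul, norm_one]
        nlinarith [hle n, norm_nonneg ((q ^ 2) ^ n), norm_nonneg q]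
      have a2 : 4 / 5 ≤ ‖1 + (q ^ 2) ^ (k + n + 1)‖ := by
        have := norm_sub_norm_le (1 : ℂ) (-(q ^ 2) ^ (k + n + 1))
        rw [norm_neg, norm_one, sub_neg_eq_add] at this
        have := hk2 (n + 1)
        rw [← add_assoc] at this
        linarith
      rw [div_le_iff₀ (by linarith)]
      nlinarith [hk2 1, norm_nonneg (1 - q * (q ^ 2) ^ n), norm_nonneg ((q ^ 2) ^ (k + 1))]
  exact tsum_of_norm_bounded hasSum_geometric_two hb

lemma partial_id (q : ℂ) (hq : ‖q‖ < 1) (N : ℕ) :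
    (q - 1) * (FT q 0 - aT q N * (q ^ 2) ^ N * FT q N) =
      ∑ k ∈ Finset.range N, aT q k - 2 + aT q N * (1 + (q ^ 2) ^ N) := by
  induction N with
  | zero => simp [aT, qPoch_zero']; norm_num
  | succ N ih =>
    rw [Finset.sum_range_succ, aT_succ q hq]
    have h1 := one_add_pow_ne q hq N
    have hr := FT_rec q hq N
    have hF : FT q N = (1 + (q ^ 2) ^ (N + 1) * (q + (q ^ 2) ^ (N + 1)) / (1 + (q ^ 2) ^ (N + 1))
        * FT q (N + 1)) / (1 + (q ^ 2) ^ (N + 1)) := by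
      rw [eq_div_iff h1]; linear_combination hr
    rw [hF] at ih
    rw [pow_succ (q ^ 2) N] at *
    generalize (q ^ 2) ^ N = y at *
    have key : ∀ S : ℂ, (q - 1) * (FT q 0 - aT q N * y * ((1 + y * q ^ 2 * (q + y * q ^ 2) /
        (1 + y * q ^ 2) * FT q (N + 1)) / (1 + y * q ^ 2))) = S - 2 + aT q N * (1 + y) →
        (q - 1) * (FT q 0 - (1 + q * y) * (q * y) / (1 + y * q ^ 2) ^ 2 * aT q N * (y * q ^ 2)
          * FT q (N + 1)) = S + aT q N - 2 + (1 + q * y) * (q * y) / (1 + y * q ^ 2) ^ 2 * aT q N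
          * (1 + y * q ^ 2) := by
      intro S hS
      have : S = (q - 1) * (FT q 0 - aT q N * y * ((1 + y * q ^ 2 * (q + y * q ^ 2) /
        (1 + y * q ^ 2) * FT q (N + 1)) / (1 + y * q ^ 2))) + 2 - aT q N * (1 + y) := by
        linear_combination -hS
      rw [this]
      have h1' : 1 + q ^ 2 * y ≠ 0 := by rwa [mul_comm]
      field_simp
      ring
    exact key _ ih

lemma FT_zero (q : ℂ) (hq : ‖q‖ < 1) : (q - 1) * FT q 0 = ∑' n, aT q n - 2 := by
  have hs := aT_summable q hq
  have ha := hs.tendsto_atTop_zero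
  have hp := tendsto_p q hq
  have h1 : Tendsto (fun N => aT q N * (q ^ 2) ^ N * FT q N) atTop (𝓝 0) := by
    have h0 : Tendsto (fun N => aT q N * (q ^ 2) ^ N) atTop (𝓝 0) := by simpa using ha.mul hp
    refine NormedField.tendsto_zero_smul_of_tendsto_zero_of_bounded h0 ?_
    exact ⟨2, by simpa using FT_bound q hq⟩
  have h2 := (h1.const_sub (FT q 0)).const_mul (q - 1)
  have h3 := (hs.hasSum.tendsto_sum_nat.sub_const 2).add (ha.mul (hp.const_add 1))
  have := tendsto_nhds_unique (h2.congr (partial_id q hq)) h3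
  simpa using this

/-- For 0<|q|<1,
`∑_{n≥1} (1/q;q²)_{n+1} (-1)^n q^{2n+1}/(-q²;q²)_n
  = ∑_{n≥1} (-q;q²)_n q^{n²}/(-q²;q²)_n² - q`. -/
theorem stmt_10 (q : ℂ) (hq0 : q ≠ 0) (hq : ‖q‖ < 1) :
    ∑' n : ℕ, qPoch (1 / q) (q ^ 2) (n + 2) * (-1 : ℂ) ^ (n + 1) * q ^ (2 * (n + 1) + 1) /
        qPoch (-q ^ 2) (q ^ 2) (n + 1)
      = (∑' n : ℕ, qPoch (-q) (q ^ 2) (n + 1) * q ^ ((n + 1) ^ 2) /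
          (qPoch (-q ^ 2) (q ^ 2) (n + 1)) ^ 2) - q := by
  have e1 := (fT_summable q hq 0).tsum_eq_zero_add
  have e2 := (aT_summable q hq).tsum_eq_zero_add
  have e3 := FT_zero q hq
  have f0 : fT q 0 0 = 1 := by simp [fT, qPoch_zero']
  have a0 : aT q 0 = 1 := by simp [aT, qPoch_zero']
  have hL : ∀ n : ℕ, qPoch (1 / q) (q ^ 2) (n + 2) * (-1 : ℂ) ^ (n + 1) * q ^ (2 * (n + 1) + 1) /
      qPoch (-q ^ 2) (q ^ 2) (n + 1) = (q - 1) * fT q 0 (n + 1) := by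
    intro n
    have e : 1 / q * q ^ 2 = q := by field_simp
    rw [qPoch_first, e]
    simp only [fT, zero_add, pow_one]
    rw [neg_pow (q ^ 2) (n + 1), ← pow_mul, pow_succ q (2 * (n + 1))]
    field_simp
  simp only [hL]
  rw [tsum_mul_left]
  change _ = (∑' n, aT q (n + 1)) - q
  rw [FT, e1, e2, f0, a0] at e3
  linear_combination e3
end

section
/- For |q|<1, with P_ev(q) := ∑_{n≥0} (−q^{2n+2},−q^{2n+3};q²)_∞ q^{2n+1}/(q^{2n+2};q²)_∞ + ∑_{n≥1} (−q^{2n},−q^{2n+1};q²)_∞ q^{2n}/(q^{2n};q²)_∞, one has P_ev(q) = ((1+q)/(2(q;q)_∞))·(1 − (q;q)_∞²/(−q;q)_∞²) + (1+q)(φ(−q) − 1), where φ(q) = ∑_{n≥0} q^{n²}/(−q²;q²)_n. -/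
open scoped BigOperators

/-- The infinite q-Pochhammer symbol `(a;q)_∞ = ∏_{j=0}^{∞} (1 - a q^j)`. -/
noncomputable def qPochInf (a q : ℂ) : ℂ := ∏' j : ℕ, (1 - a * q ^ j)

/-- Ramanujan's third order mock theta function `φ(q) = ∑_{n≥0} q^{n²}/(-q²;q²)_n`. -/
noncomputable def mockPhi (q : ℂ) : ℂ := ∑' n : ℕ, q ^ (n ^ 2) / qPoch (-q ^ 2) (q ^ 2) n

/-- The generating function of `p̄_ev(n)`:
`P_ev(q) = ∑_{n≥0} (-q^{2n+2},-q^{2n+3};q²)_∞ q^{2n+1}/(q^{2n+2};q²)_∞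
  + ∑_{n≥1} (-q^{2n},-q^{2n+1};q²)_∞ q^{2n}/(q^{2n};q²)_∞`. -/
noncomputable def Pev (q : ℂ) : ℂ :=
  (∑' n : ℕ, qPochInf (-q ^ (2 * n + 2)) (q ^ 2) * qPochInf (-q ^ (2 * n + 3)) (q ^ 2) *
      q ^ (2 * n + 1) / qPochInf (q ^ (2 * n + 2)) (q ^ 2))
  + ∑' n : ℕ, qPochInf (-q ^ (2 * (n + 1))) (q ^ 2) * qPochInf (-q ^ (2 * (n + 1) + 1)) (q ^ 2) *
      q ^ (2 * (n + 1)) / qPochInf (q ^ (2 * (n + 1))) (q ^ 2)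

open Filter Topology

lemma hasSum_fc {ι : Type*} {f g : ι → ℂ} {a : ℂ} (h : ∀ n, f n = g n) (hg : HasSum g a) :
    HasSum f a := by
  rw [show f = g from funext h]; exact hg

section basics

variable {p : ℂ}

lemma qp_summable (hp : ‖p‖ < 1) (z : ℂ) : Summable fun j : ℕ => ‖-(z * p ^ j)‖ := by
  simp only [norm_neg, norm_mul, norm_pow]
  exact (summable_geometric_of_lt_one (norm_nonneg _) hp).mul_left _

lemma qp_mult (hp : ‖p‖ < 1) (z : ℂ) : Multipliable fun j : ℕ => 1 - z * p ^ j := by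
  simpa [sub_eq_add_neg] using multipliable_one_add_of_summable (qp_summable hp z)

lemma qp_tendsto_poch (hp : ‖p‖ < 1) (z : ℂ) :
    Tendsto (fun k => qPoch z p k) atTop (𝓝 (qPochInf z p)) :=
  (qp_mult hp z).tendsto_prod_tprod_nat

lemma qp_split (hp : ‖p‖ < 1) (z : ℂ) (k : ℕ) :
    qPochInf z p = qPoch z p k * qPochInf (z * p ^ k) p := by
  have h := (qp_mult hp (z * p ^ k)).hasProd
  have h2 : HasProd (fun n : ℕ => (fun j : ℕ => 1 - z * p ^ j) (n + k)) (qPochInf (z * p ^ k) p) := by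
    have e : (fun n : ℕ => (fun j : ℕ => 1 - z * p ^ j) (n + k)) =
        fun j : ℕ => 1 - z * p ^ k * p ^ j := by
      funext n
      simp only [pow_add]
      ring
    rw [e]
    exact h
  exact (HasProd.prod_range_mul (f := fun j : ℕ => 1 - z * p ^ j) h2).tprod_eq

lemma qp_step (hp : ‖p‖ < 1) (z : ℂ) : qPochInf z p = (1 - z) * qPochInf (z * p) p := by
  have := qp_split hp z 1
  simpa [qPoch] using this

lemma qp_sub_one_fin (hp : ‖p‖ < 1) (z : ℂ) (k : ℕ) :
    ‖qPoch z p k - 1‖ ≤ Real.exp (‖z‖ / (1 - ‖p‖)) - 1 := by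
  have h := Finset.norm_prod_one_add_sub_one_le (Finset.range k) (fun j : ℕ => -(z * p ^ j))
  simp only [← sub_eq_add_neg] at h
  refine h.trans ?_
  gcongr
  have h2 := (qp_summable hp z).sum_le_tsum (Finset.range k) (fun _ _ => norm_nonneg _)
  refine h2.trans (le_of_eq ?_)
  simp only [norm_neg, norm_mul, norm_pow]
  rw [tsum_mul_left, tsum_geometric_of_lt_one (norm_nonneg _) hp]
  rfl

lemma qp_sub_one (hp : ‖p‖ < 1) (z : ℂ) :
    ‖qPochInf z p - 1‖ ≤ Real.exp (‖z‖ / (1 - ‖p‖)) - 1 :=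
  le_of_tendsto ((qp_tendsto_poch hp z).sub_const 1).norm
    (Eventually.of_forall fun k => qp_sub_one_fin hp z k)

lemma qp_bd_fin (hp : ‖p‖ < 1) (z : ℂ) (hz : ‖z‖ ≤ 1) (k : ℕ) :
    ‖qPoch z p k‖ ≤ Real.exp (1 / (1 - ‖p‖)) := by
  have h := qp_sub_one_fin hp z k
  have h2 : ‖qPoch z p k‖ ≤ ‖qPoch z p k - 1‖ + ‖(1 : ℂ)‖ := by
    simpa using norm_add_le (qPoch z p k - 1) 1
  have h3 : Real.exp (‖z‖ / (1 - ‖p‖)) ≤ Real.exp (1 / (1 - ‖p‖)) := by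
    have : 0 < 1 - ‖p‖ := by linarith
    gcongr
  rw [norm_one] at h2
  linarith

lemma qp_bd (hp : ‖p‖ < 1) (z : ℂ) (hz : ‖z‖ ≤ 1) :
    ‖qPochInf z p‖ ≤ Real.exp (1 / (1 - ‖p‖)) :=
  le_of_tendsto (qp_tendsto_poch hp z).norm
    (Eventually.of_forall fun k => qp_bd_fin hp z hz k)

lemma qp_tendsto_one (hp : ‖p‖ < 1) {u : ℕ → ℂ} (hu : Tendsto u atTop (𝓝 0)) :
    Tendsto (fun k => qPochInf (u k) p) atTop (𝓝 1) := by
  rw [tendsto_iff_norm_sub_tendsto_zero]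
  refine squeeze_zero (fun _ => norm_nonneg _) (fun k => qp_sub_one hp (u k)) ?_
  have h : Tendsto (fun k => Real.exp (‖u k‖ / (1 - ‖p‖)) - 1) atTop
      (𝓝 (Real.exp (‖(0 : ℂ)‖ / (1 - ‖p‖)) - 1)) :=
    ((Real.continuous_exp.tendsto _).comp (hu.norm.div_const _)).sub_const 1
  simpa using h

lemma qp_ne (hp : ‖p‖ < 1) (z : ℂ) (hz : ∀ j : ℕ, z * p ^ j ≠ 1) : qPochInf z p ≠ 0 := by
  have := tprod_one_add_ne_zero_of_summable (f := fun j : ℕ => -(z * p ^ j))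
    (fun j h => hz j (by linear_combination -h)) (qp_summable hp z)
  simpa [qPochInf, sub_eq_add_neg] using this

lemma qp_ne_of_lt (hp : ‖p‖ < 1) (z : ℂ) (hz : ‖z‖ < 1) : qPochInf z p ≠ 0 := by
  refine qp_ne hp z fun j h => ?_
  have h1 : ‖z * p ^ j‖ = 1 := by rw [h, norm_one]
  rw [norm_mul, norm_pow] at h1
  have : ‖z‖ * ‖p‖ ^ j ≤ ‖z‖ * 1 := by
    gcongr
    exact pow_le_one₀ (norm_nonneg _) hp.le
  linarith

lemma qp_ne_neg_one (hp : ‖p‖ < 1) : qPochInf (-1) p ≠ 0 := by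
  rw [qp_step hp]
  refine mul_ne_zero (by norm_num) (qp_ne_of_lt hp _ (by simpa using hp))

lemma pow_ne_neg_one (hp : ‖p‖ < 1) (n : ℕ) : 1 + p ^ n ≠ 0 := by
  rcases n with _ | n
  · norm_num
  · intro h
    have h1 : ‖p ^ (n + 1)‖ = 1 := by
      rw [show p ^ (n + 1) = -1 by linear_combination h]; simp
    rw [norm_pow] at h1
    have := pow_lt_one₀ (norm_nonneg p) hp (Nat.succ_ne_zero n)
    simp only [Nat.succ_eq_add_one] at this
    linarith

lemma tendsto_mul_pow_zero (hp : ‖p‖ < 1) (b : ℂ) : Tendsto (fun k : ℕ => b * p ^ k) atTop (𝓝 0) := by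
  simpa using (tendsto_pow_atTop_nhds_zero_of_norm_lt_one hp).const_mul b

lemma norm_mul_pow_le (hp : ‖p‖ < 1) (b : ℂ) (k : ℕ) : ‖b * p ^ k‖ ≤ ‖b‖ := by
  rw [norm_mul, norm_pow]
  exact mul_le_of_le_one_right (norm_nonneg _) (pow_le_one₀ (norm_nonneg _) hp.le)

/-- Series with bounded coefficients. -/
lemma bdd_series {c : ℕ → ℂ} {K : ℝ} (hc : ∀ n, ‖c n‖ ≤ K) {t : ℂ} (ht : ‖t‖ < 1) :
    Summable (fun n => c n * t ^ n) ∧ ‖∑' n, c n * t ^ n‖ ≤ K * (1 - ‖t‖)⁻¹ := by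
  have hs : HasSum (fun n : ℕ => K * ‖t‖ ^ n) (K * (1 - ‖t‖)⁻¹) :=
    (hasSum_geometric_of_lt_one (norm_nonneg _) ht).mul_left K
  have hb : ∀ n, ‖c n * t ^ n‖ ≤ K * ‖t‖ ^ n := fun n => by
    rw [norm_mul, norm_pow]
    gcongr
    exact hc n
  exact ⟨hs.summable.of_norm_bounded hb, tsum_of_norm_bounded hs hb⟩

end basics

section partone

variable {p : ℂ}

noncomputable def rr (p : ℂ) (n : ℕ) : ℂ := qPochInf (-p ^ (n + 1)) p / qPochInf (p ^ (n + 1)) p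

noncomputable def HH (p b : ℂ) : ℂ := ∑' n : ℕ, (rr p n * qPochInf (-b * p ^ (n + 1)) p) * p ^ n

noncomputable def MM (p b : ℂ) : ℂ :=
  ∑' m : ℕ, ((-1) ^ m * p ^ (m * (m + 1) / 2) / qPoch (-p) p (m + 1)) * b ^ m

noncomputable def LL (p b : ℂ) : ℂ := ∑' m : ℕ, (2 * (-1) ^ m / (1 + p ^ (m + 1))) * b ^ m

lemma norm_pow_succ_lt (hp : ‖p‖ < 1) (n : ℕ) : ‖p ^ (n + 1)‖ < 1 := by
  rw [norm_pow]; exact pow_lt_one₀ (norm_nonneg p) hp (Nat.succ_ne_zero n)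

lemma qPoch_ne_s17 (hp : ‖p‖ < 1) (z : ℂ) (hz : ‖z‖ < 1) (n : ℕ) : qPoch z p n ≠ 0 := by
  intro h
  have := qp_split hp z n
  rw [h, zero_mul] at this
  exact qp_ne_of_lt hp z hz this

lemma rr_bd (hp : ‖p‖ < 1) : ∃ K, ∀ n, ‖rr p n‖ ≤ K := by
  refine ⟨Real.exp (1 / (1 - ‖p‖)) * (Real.exp (1 / (1 - ‖p‖)) / ‖qPochInf p p‖), fun n => ?_⟩
  have h0 := qp_ne_of_lt hp p hp
  have h1 := qp_ne_of_lt hp (p ^ (n + 1)) (norm_pow_succ_lt hp n)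
  have h := qp_split hp p n
  rw [show p * p ^ n = p ^ (n + 1) by ring] at h
  have e : rr p n = qPochInf (-p ^ (n + 1)) p * (qPoch p p n / qPochInf p p) := by
    have h2 := qPoch_ne_s17 hp p hp n
    rw [rr, h]
    field_simp
  rw [e, norm_mul, norm_div]
  gcongr
  · exact qp_bd hp _ (by rw [norm_neg]; exact (norm_pow_succ_lt hp n).le)
  · exact qp_bd_fin hp _ hp.le n

lemma rr_succ (hp : ‖p‖ < 1) (n : ℕ) :
    rr p (n + 1) * (1 + p ^ (n + 1)) = rr p n * (1 - p ^ (n + 1)) := by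
  have h1 := qp_ne_of_lt hp (p ^ (n + 1)) (norm_pow_succ_lt hp n)
  have h2 := qp_ne_of_lt hp (p ^ (n + 1 + 1)) (norm_pow_succ_lt hp (n + 1))
  have e1 := qp_step hp (p ^ (n + 1))
  have e2 := qp_step hp (-p ^ (n + 1))
  rw [show p ^ (n + 1) * p = p ^ (n + 1 + 1) by ring] at e1
  rw [show -p ^ (n + 1) * p = -p ^ (n + 1 + 1) by ring] at e2
  have h3 : (1 - p ^ (n + 1)) ≠ 0 := by
    intro h; rw [h, zero_mul] at e1; exact h1 e1
  rw [rr, rr, e1, e2]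
  field_simp
  ring

lemma HH_coef_bd (hp : ‖p‖ < 1) : ∃ K, ∀ b : ℂ, ‖b‖ ≤ 1 → ∀ n : ℕ,
    ‖rr p n * qPochInf (-b * p ^ (n + 1)) p‖ ≤ K := by
  obtain ⟨K, hK⟩ := rr_bd hp
  refine ⟨K * Real.exp (1 / (1 - ‖p‖)), fun b hb n => ?_⟩
  have hK0 : 0 ≤ K := (norm_nonneg _).trans (hK 0)
  rw [norm_mul]
  gcongr
  · exact hK n
  · exact qp_bd hp _ ((norm_mul_pow_le hp _ _).trans (by simpa using hb))

lemma HH_eq (hp : ‖p‖ < 1) {b : ℂ} (hb : ‖b‖ < 1) :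
    HH p b + p * (1 + b) * HH p (b * p) = 2 * rr p 0 * qPochInf (-b * p) p - 1 := by
  obtain ⟨K, hK⟩ := HH_coef_bd hp
  have hbp : ‖b * p‖ ≤ 1 := by
    have := norm_mul_pow_le hp b 1
    rw [pow_one] at this
    linarith
  have s1 := (bdd_series (hK b hb.le) hp).1
  have s2 := (bdd_series (hK (b * p) hbp) hp).1
  have hs := (s1.hasSum.add (s2.hasSum.mul_left (p * (1 + b)))).tendsto_sum_nat
  refine tendsto_nhds_unique hs ?_
  set T : ℕ → ℂ := fun n => (1 + p ^ n) * rr p n * qPochInf (-b * p ^ (n + 1)) p with hT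
  have tel : ∀ N, ∑ n ∈ Finset.range N, (rr p n * qPochInf (-b * p ^ (n + 1)) p * p ^ n +
      p * (1 + b) * (rr p n * qPochInf (-(b * p) * p ^ (n + 1)) p * p ^ n)) = T 0 - T N := by
    intro N
    rw [← Finset.sum_range_sub']
    refine Finset.sum_congr rfl fun n _ => ?_
    have e := qp_step hp (-b * p ^ (n + 1))
    rw [show -b * p ^ (n + 1) * p = -b * p ^ (n + 1 + 1) by ring] at e
    have r := rr_succ hp n
    rw [show -(b * p) * p ^ (n + 1) = -b * p ^ (n + 1 + 1) by ring]
    simp only [hT]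
    rw [e]
    linear_combination (qPochInf (-b * p ^ (n + 1 + 1)) p) * r
  have e0 : T 0 = 2 * rr p 0 * qPochInf (-b * p) p := by
    simp only [hT]; norm_num
  rw [← e0]
  refine Tendsto.congr (fun N => (tel N).symm) ?_
  refine Tendsto.const_sub _ ?_
  have t0 : Tendsto (fun n : ℕ => p ^ (n + 1)) atTop (𝓝 0) :=
    (tendsto_pow_atTop_nhds_zero_of_norm_lt_one hp).comp (tendsto_add_atTop_nat 1)
  have t1 := qp_tendsto_one hp t0
  have t2 := qp_tendsto_one hp (u := fun n : ℕ => -p ^ (n + 1)) (by simpa using t0.neg)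
  have t3 := qp_tendsto_one hp (u := fun n : ℕ => -b * p ^ (n + 1)) (by simpa using t0.const_mul (-b))
  have t4 : Tendsto (fun n : ℕ => 1 + p ^ n) atTop (𝓝 1) := by
    simpa using (tendsto_pow_atTop_nhds_zero_of_norm_lt_one hp).const_add 1
  simpa [hT, rr] using (t4.mul (t2.div t1 one_ne_zero)).mul t3

lemma MM_coef_bd (hp : ‖p‖ < 1) : ∃ K, ∀ m : ℕ,
    ‖(-1) ^ m * p ^ (m * (m + 1) / 2) / qPoch (-p) p (m + 1)‖ ≤ K := by
  refine ⟨Real.exp (1 / (1 - ‖p‖)) / ‖qPochInf (-p) p‖, fun m => ?_⟩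
  have hn : ‖-p‖ < 1 := by simpa using hp
  have h0 := qp_ne_of_lt hp (-p) hn
  have h2 := qPoch_ne_s17 hp (-p) hn (m + 1)
  have h := qp_split hp (-p) (m + 1)
  have e : (-1) ^ m * p ^ (m * (m + 1) / 2) / qPoch (-p) p (m + 1) =
      (-1) ^ m * p ^ (m * (m + 1) / 2) * (qPochInf (-p * p ^ (m + 1)) p / qPochInf (-p) p) := by
    have h3 : qPochInf (-p * p ^ (m + 1)) p ≠ 0 := by
      intro h_alt; rw [h_alt, mul_zero] at h; exact h0 h
    rw [h]
    generalize qPochInf (-p * p ^ (m + 1)) p = X at h3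
    field_simp
  rw [e, norm_mul, norm_mul, norm_pow, norm_neg, norm_one, one_pow, one_mul, norm_pow, norm_div]
  refine (mul_le_of_le_one_left (by positivity) (pow_le_one₀ (norm_nonneg _) hp.le)).trans ?_
  gcongr
  exact qp_bd hp _ ((norm_mul_pow_le hp _ _).trans hn.le)

lemma MM_eq (hp : ‖p‖ < 1) {b : ℂ} (hb : ‖b‖ < 1) :
    MM p b = 1 - p * (1 + b) * MM p (b * p) := by
  obtain ⟨K, hK⟩ := MM_coef_bd hp
  have hbp : ‖b * p‖ < 1 := by
    have := norm_mul_pow_le hp b 1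
    rw [pow_one] at this
    linarith
  have s1 := (bdd_series hK hb).1
  have s2 := (bdd_series hK hbp).1
  have hn : ‖-p‖ < 1 := by simpa using hp
  set c : ℕ → ℂ := fun m => (-1) ^ m * p ^ (m * (m + 1) / 2) / qPoch (-p) p (m + 1) with hc
  have tri : ∀ m : ℕ, (m + 1) * (m + 1 + 1) / 2 = m * (m + 1) / 2 + (m + 1) := by
    intro m
    rw [show (m + 1) * (m + 1 + 1) = m * (m + 1) + (m + 1) * 2 by ring,
      Nat.add_mul_div_right _ _ (by norm_num)]
  have a1 : HasSum (fun m => c m * b ^ m + p * (c m * (b * p) ^ m)) (MM p b + p * MM p (b * p)) :=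
    s1.hasSum.add (s2.hasSum.mul_left p)
  have key : ∀ m, c (m + 1) * b ^ (m + 1) + p * (c (m + 1) * (b * p) ^ (m + 1)) =
      -(b * p) * (c m * (b * p) ^ m) := by
    intro m
    have h1 := qPoch_ne_s17 hp (-p) hn (m + 1)
    have h2 : 1 + p ^ (m + 2) ≠ 0 := pow_ne_neg_one hp _
    have e : qPoch (-p) p (m + 1 + 1) = qPoch (-p) p (m + 1) * (1 + p ^ (m + 2)) := by
      rw [qPoch, Finset.prod_range_succ, ← qPoch]; ring
    simp only [hc, tri, e]
    field_simp
    ring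
  have a2 := a1.summable.tsum_eq_zero_add
  rw [a1.tsum_eq] at a2
  simp only [key] at a2
  rw [tsum_mul_left] at a2
  have e0 : c 0 * b ^ 0 + p * (c 0 * (b * p) ^ 0) = 1 := by
    have h2 : 1 + p ≠ 0 := by simpa using pow_ne_neg_one hp 1
    simp [hc, qPoch]
    field_simp
  rw [e0] at a2
  have : MM p (b * p) = ∑' m, c m * (b * p) ^ m := rfl
  rw [← this] at a2
  linear_combination a2

lemma LL_coef_bd (hp : ‖p‖ < 1) : ∃ K, ∀ m : ℕ, ‖2 * (-1) ^ m / (1 + p ^ (m + 1))‖ ≤ K := by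
  refine ⟨2 / (1 - ‖p‖), fun m => ?_⟩
  have h : 1 - ‖p‖ ≤ ‖1 + p ^ (m + 1)‖ := by
    have h1 : ‖p ^ (m + 1)‖ ≤ ‖p‖ := by
      have := norm_mul_pow_le hp p m
      rwa [← pow_succ'] at this
    have h2 := norm_sub_le (1 + p ^ (m + 1)) (p ^ (m + 1))
    simp only [add_sub_cancel_right, norm_one] at h2
    linarith
  have h0 : 0 < 1 - ‖p‖ := by linarith
  rw [norm_div]
  gcongr
  simp

lemma LL_eq (hp : ‖p‖ < 1) {b : ℂ} (hb : ‖b‖ < 1) :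
    (1 + b) * (LL p b + p * LL p (b * p)) = 2 := by
  obtain ⟨K, hK⟩ := LL_coef_bd hp
  have hbp : ‖b * p‖ < 1 := by
    have := norm_mul_pow_le hp b 1
    rw [pow_one] at this
    linarith
  have s1 := (bdd_series hK hb).1
  have s2 := (bdd_series hK hbp).1
  have a1 := s1.hasSum.add (s2.hasSum.mul_left p)
  have g := (hasSum_geometric_of_norm_lt_one (ξ := -b) (by simpa using hb)).mul_left 2
  have : LL p b + p * LL p (b * p) = 2 * (1 - -b)⁻¹ := by
    refine a1.unique ?_
    refine hasSum_fc (fun m => ?_) g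
    have h2 : 1 + p ^ (m + 1) ≠ 0 := pow_ne_neg_one hp _
    field_simp
    rw [mul_pow, neg_pow b]
    ring
  rw [this]
  have h3 : 1 + b ≠ 0 := by simpa using pow_ne_neg_one hb 1
  rw [sub_neg_eq_add]
  field_simp

lemma main_one (hp : ‖p‖ < 1) {b : ℂ} (hb : ‖b‖ < 1) :
    HH p b = - MM p b + rr p 0 * qPochInf (-b) p * LL p b := by
  set D : ℂ → ℂ := fun b => HH p b + MM p b - rr p 0 * qPochInf (-b) p * LL p b with hD
  have step : ∀ b : ℂ, ‖b‖ < 1 → D b = -p * (1 + b) * D (b * p) := by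
    intro b hb
    have e := qp_step hp (-b)
    have h1 := HH_eq hp hb
    have h2 := MM_eq hp hb
    have h3 := LL_eq hp hb
    simp only [hD]
    rw [show -(b * p) = -b * p by ring, e]
    linear_combination h1 + h2 - rr p 0 * qPochInf (-b * p) p * h3
  have iter : ∀ k : ℕ, D b = (-p) ^ k * qPoch (-b) p k * D (b * p ^ k) := by
    intro k
    induction k with
    | zero => simp [qPoch]
    | succ k ih =>
      rw [ih, step (b * p ^ k) ((norm_mul_pow_le hp b k).trans_lt hb)]
      have : qPoch (-b) p (k + 1) = qPoch (-b) p k * (1 + b * p ^ k) := by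
        rw [qPoch, Finset.prod_range_succ, ← qPoch]; ring
      rw [this, show b * p ^ k * p = b * p ^ (k + 1) by ring]
      ring
  have bd : ∃ K, ∀ k : ℕ, ‖D (b * p ^ k)‖ ≤ K := by
    obtain ⟨K1, hK1⟩ := HH_coef_bd hp
    obtain ⟨K2, hK2⟩ := MM_coef_bd hp
    obtain ⟨K3, hK3⟩ := LL_coef_bd hp
    have K20 := (norm_nonneg _).trans (hK2 0)
    have K30 := (norm_nonneg _).trans (hK3 0)
    refine ⟨K1 * (1 - ‖p‖)⁻¹ + K2 * (1 - ‖b‖)⁻¹ +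
      ‖rr p 0‖ * Real.exp (1 / (1 - ‖p‖)) * (K3 * (1 - ‖b‖)⁻¹), fun k => ?_⟩
    have hk := norm_mul_pow_le hp b k
    have hk1 := hk.trans_lt hb
    have b1 := (bdd_series (hK1 _ hk1.le) hp).2
    have b2 := (bdd_series hK2 hk1).2
    have b3 := (bdd_series hK3 hk1).2
    have hinv : (1 - ‖b * p ^ k‖)⁻¹ ≤ (1 - ‖b‖)⁻¹ := by
      have : 0 < 1 - ‖b‖ := by linarith
      gcongr
    have b2_alt := b2.trans (mul_le_mul_of_nonneg_left hinv K20)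
    have b3_alt := b3.trans (mul_le_mul_of_nonneg_left hinv K30)
    refine (norm_sub_le _ _).trans (add_le_add ((norm_add_le _ _).trans (add_le_add b1 b2_alt)) ?_)
    rw [norm_mul, norm_mul]
    gcongr
    · exact qp_bd hp _ (by rw [norm_neg]; exact hk1.le)
    · exact b3_alt
  have D0 : D b = 0 := by
    obtain ⟨K, hK⟩ := bd
    have hK0 := (norm_nonneg _).trans (hK 0)
    have t : Tendsto (fun k : ℕ => ‖p‖ ^ k * (Real.exp (1 / (1 - ‖p‖)) * K)) atTop (𝓝 0) := by
      simpa using (tendsto_pow_atTop_nhds_zero_of_lt_one (norm_nonneg _) hp).mul_const _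
    have h : ‖D b‖ ≤ 0 := by
      refine ge_of_tendsto t (Eventually.of_forall fun k => ?_)
      rw [iter k, norm_mul, norm_mul, norm_pow, norm_neg, mul_assoc]
      gcongr
      · exact qp_bd_fin hp _ (by rw [norm_neg]; exact hb.le) k
      · exact hK k
    simpa using h
  simp only [hD] at D0
  linear_combination D0

end partone

section parttwo

variable {p : ℂ}

noncomputable def cc (p : ℂ) (n : ℕ) : ℂ := qPochInf (p ^ (n + 1)) p / qPochInf (-p ^ n) p

lemma neg_pow_inv (hp : ‖p‖ < 1) (n : ℕ) :
    (qPochInf (-p ^ n) p)⁻¹ = qPoch (-1) p n / qPochInf (-1) p := by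
  have h0 := qp_ne_neg_one hp
  have h := qp_split hp (-1) n
  rw [show -1 * p ^ n = -p ^ n by ring] at h
  have h1 : qPoch (-1) p n ≠ 0 := by
    intro h_alt; rw [h_alt, zero_mul] at h; exact h0 h
  have h2 : qPochInf (-p ^ n) p ≠ 0 := by
    intro h_alt; rw [h_alt, mul_zero] at h; exact h0 h
  rw [h]
  field_simp

lemma neg_pow_ne (hp : ‖p‖ < 1) (n : ℕ) : qPochInf (-p ^ n) p ≠ 0 := by
  have h0 := qp_ne_neg_one hp
  have h := qp_split hp (-1) n
  rw [show -1 * p ^ n = -p ^ n by ring] at h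
  intro h_alt; rw [h_alt, mul_zero] at h; exact h0 h

lemma quot_bd (hp : ‖p‖ < 1) (z : ℂ) (hz : ‖z‖ ≤ 1) (n : ℕ) :
    ‖qPochInf z p / qPochInf (-p ^ n) p‖ ≤ Real.exp (1 / (1 - ‖p‖)) *
      (Real.exp (1 / (1 - ‖p‖)) / ‖qPochInf (-1) p‖) := by
  rw [div_eq_mul_inv, neg_pow_inv hp, norm_mul, norm_div]
  gcongr
  · exact qp_bd hp _ hz
  · exact qp_bd_fin hp _ (by simp) n

lemma cc_succ (hp : ‖p‖ < 1) (n : ℕ) : cc p (n + 1) * (1 - p ^ (n + 1)) = cc p n * (1 + p ^ n) := by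
  have h1 := neg_pow_ne hp n
  have h2 := neg_pow_ne hp (n + 1)
  have e1 := qp_step hp (p ^ (n + 1))
  have e2 := qp_step hp (-p ^ n)
  rw [show p ^ (n + 1) * p = p ^ (n + 1 + 1) by ring] at e1
  rw [show -p ^ n * p = -p ^ (n + 1) by ring] at e2
  have h3 := pow_ne_neg_one hp n
  rw [cc, cc, e1, e2, sub_neg_eq_add]
  field_simp

lemma qbinom (hp : ‖p‖ < 1) {x : ℂ} (hx : ‖x‖ < 1) :
    (∑' n : ℕ, cc p n * x ^ n) * qPochInf x p = qPochInf (-x) p * cc p 0 := by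
  have hc : ∀ n, ‖cc p n‖ ≤ _ := fun n => quot_bd hp (p ^ (n + 1)) (norm_pow_succ_lt hp n).le n
  set F : ℂ → ℂ := fun x => ∑' n : ℕ, cc p n * x ^ n with hF
  have step : ∀ x : ℂ, ‖x‖ < 1 → F x * (1 - x) = (1 + x) * F (x * p) := by
    intro x hx
    have hxp : ‖x * p‖ < 1 := by
      have := norm_mul_pow_le hp x 1
      rw [pow_one] at this
      linarith
    have s1 := (bdd_series hc hx).1
    have s2 := (bdd_series hc hxp).1
    have a1 := s1.hasSum.sub s2.hasSum
    have a2 := (s1.hasSum.add s2.hasSum).mul_left x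
    have a3 := a1.summable.tsum_eq_zero_add
    rw [a1.tsum_eq] at a3
    have key : ∀ n, cc p (n + 1) * x ^ (n + 1) - cc p (n + 1) * (x * p) ^ (n + 1) =
        x * (cc p n * x ^ n + cc p n * (x * p) ^ n) := by
      intro n
      have := cc_succ hp n
      rw [mul_pow, mul_pow]
      linear_combination x ^ (n + 1) * this
    simp only [key] at a3
    rw [a2.tsum_eq] at a3
    simp only [pow_zero, sub_self, zero_add] at a3
    simp only [hF]
    linear_combination a3
  have iter : ∀ k : ℕ, F x * qPoch x p k = qPoch (-x) p k * F (x * p ^ k) := by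
    intro k
    induction k with
    | zero => simp [qPoch]
    | succ k ih =>
      have h := step (x * p ^ k) ((norm_mul_pow_le hp x k).trans_lt hx)
      have e1 : qPoch (-x) p (k + 1) = qPoch (-x) p k * (1 + x * p ^ k) := by
        rw [qPoch, Finset.prod_range_succ, ← qPoch]; ring
      have e2 : qPoch x p (k + 1) = qPoch x p k * (1 - x * p ^ k) := by
        rw [qPoch, Finset.prod_range_succ, ← qPoch]
      rw [show x * p ^ k * p = x * p ^ (k + 1) by ring] at h
      rw [e1, e2]
      linear_combination (1 - x * p ^ k) * ih + qPoch (-x) p k * h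
  have lim : Tendsto (fun k : ℕ => F (x * p ^ k)) atTop (𝓝 (cc p 0)) := by
    have hc0 := (norm_nonneg _).trans (hc 0)
    set K := Real.exp (1 / (1 - ‖p‖)) * (Real.exp (1 / (1 - ‖p‖)) / ‖qPochInf (-1) p‖) with hK
    rw [tendsto_iff_norm_sub_tendsto_zero]
    have t : Tendsto (fun k : ℕ => ‖x * p ^ k‖ * (K * (1 - ‖x‖)⁻¹)) atTop (𝓝 0) := by
      simpa using (tendsto_mul_pow_zero hp x).norm.mul_const (K * (1 - ‖x‖)⁻¹)
    refine squeeze_zero (fun _ => norm_nonneg _) (fun k => ?_) t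
    have hk := norm_mul_pow_le hp x k
    have hk1 := hk.trans_lt hx
    have e := (bdd_series hc hk1).1.tsum_eq_zero_add
    have e_alt : F (x * p ^ k) - cc p 0 = (x * p ^ k) * ∑' n : ℕ, cc p (n + 1) * (x * p ^ k) ^ n := by
      simp only [hF]
      rw [e, ← tsum_mul_left, pow_zero, mul_one, add_sub_cancel_left]
      exact tsum_congr fun n => by ring
    rw [e_alt, norm_mul]
    gcongr
    refine (bdd_series (fun n => hc (n + 1)) hk1).2.trans ?_
    have : 0 < 1 - ‖x‖ := by linarith
    gcongr
  refine tendsto_nhds_unique ((qp_tendsto_poch hp x).const_mul (F x)) ?_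
  simp only [iter]
  exact (qp_tendsto_poch hp (-x)).mul lim

noncomputable def ww (p x b : ℂ) (n : ℤ) : ℂ :=
  qPochInf (b * p ^ n) p / qPochInf (-p ^ n) p * x ^ n

lemma zpow_ne_neg_one (hp : ‖p‖ < 1) (n : ℤ) : 1 + p ^ n ≠ 0 := by
  obtain ⟨k, rfl | rfl⟩ := n.eq_nat_or_neg
  · simpa using pow_ne_neg_one hp k
  · intro h
    have h1 : (p ^ k)⁻¹ = -1 := by
      rw [zpow_neg, zpow_natCast] at h
      linear_combination h
    have h2 : p ^ k = -1 := by
      rw [← inv_inv (p ^ k), h1]; norm_num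
    exact pow_ne_neg_one hp k (by rw [h2]; norm_num)

lemma zneg_ne (hp : ‖p‖ < 1) (hp0 : p ≠ 0) (n : ℤ) : qPochInf (-p ^ n) p ≠ 0 := by
  refine qp_ne hp _ fun j h => zpow_ne_neg_one hp (n + j) ?_
  rw [zpow_add₀ hp0, zpow_natCast]
  linear_combination -h

lemma ww_step (hp : ‖p‖ < 1) (hp0 : p ≠ 0) {x : ℂ} (hx0 : x ≠ 0) (b : ℂ) (n : ℤ) :
    ww p x b n * ((1 + p ^ n) * x) = (1 - b * p ^ n) * ww p x b (n + 1) := by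
  have h2 := zneg_ne hp hp0 (n + 1)
  have h3 := zpow_ne_neg_one hp n
  have e1 := qp_step hp (b * p ^ n)
  have e2 := qp_step hp (-p ^ n)
  rw [show b * p ^ n * p = b * p ^ (n + 1) by rw [zpow_add_one₀ hp0]; ring] at e1
  rw [show -p ^ n * p = -p ^ (n + 1) by rw [zpow_add_one₀ hp0]; ring] at e2
  rw [ww, ww, e1, e2, sub_neg_eq_add, zpow_add_one₀ hx0]
  generalize qPochInf (-p ^ (n + 1)) p = X at h2
  field_simp

lemma ww_eq (hp : ‖p‖ < 1) (hp0 : p ≠ 0) {x : ℂ} (hx0 : x ≠ 0) (b : ℂ) (n : ℤ) :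
    ww p x b n - (1 + b) * ww p x (b * p) n = -(b / x) * ww p x b (n + 1) := by
  have h2 := zneg_ne hp hp0 (n + 1)
  have h3 := zpow_ne_neg_one hp n
  have e1 := qp_step hp (b * p ^ n)
  have e2 := qp_step hp (-p ^ n)
  rw [show b * p ^ n * p = b * p ^ (n + 1) by rw [zpow_add_one₀ hp0]; ring] at e1
  rw [show -p ^ n * p = -p ^ (n + 1) by rw [zpow_add_one₀ hp0]; ring] at e2
  rw [ww, ww, ww, e1, e2, sub_neg_eq_add, zpow_add_one₀ hx0,
    show b * p * p ^ n = b * p ^ (n + 1) by rw [zpow_add_one₀ hp0]; ring]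
  generalize qPochInf (-p ^ (n + 1)) p = X at h2
  generalize qPochInf (b * p ^ (n + 1)) p = Y
  field_simp
  ring

noncomputable def VV (p x : ℂ) (m : ℕ) : ℝ :=
  ∏ j ∈ Finset.range m, (‖p‖ ^ (j + 1) + ‖p‖) / (‖1 + p ^ (j + 1)‖ * ‖x‖)

lemma VV_summable (hp : ‖p‖ < 1) {x : ℂ} (hpx : ‖p‖ < ‖x‖) : Summable (VV p x) := by
  have hx : 0 < ‖x‖ := (norm_nonneg _).trans_lt hpx
  obtain ⟨r, hr1, hr2⟩ := exists_between ((div_lt_one hx).2 hpx)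
  refine summable_of_ratio_norm_eventually_le hr2 ?_
  have t0 : Tendsto (fun n : ℕ => p ^ (n + 1)) atTop (𝓝 0) :=
    (tendsto_pow_atTop_nhds_zero_of_norm_lt_one hp).comp (tendsto_add_atTop_nat 1)
  have t1 : Tendsto (fun j : ℕ => (‖p‖ ^ (j + 1) + ‖p‖) / (‖1 + p ^ (j + 1)‖ * ‖x‖)) atTop
      (𝓝 ((‖(0 : ℂ)‖ + ‖p‖) / (‖(1 : ℂ) + 0‖ * ‖x‖))) := by
    have h1 := (t0.norm.add_const ‖p‖)
    simp only [norm_pow] at h1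
    refine h1.div ((t0.const_add 1).norm.mul_const ‖x‖) ?_
    simpa using hx.ne'
  simp only [norm_zero, zero_add, add_zero, norm_one, one_mul] at t1
  filter_upwards [t1.eventually_lt_const hr1] with m hm
  have e : VV p x (m + 1) = VV p x m * ((‖p‖ ^ (m + 1) + ‖p‖) / (‖1 + p ^ (m + 1)‖ * ‖x‖)) := by
    rw [VV, Finset.prod_range_succ, ← VV]
  rw [e, norm_mul, mul_comm]
  gcongr
  rw [Real.norm_of_nonneg (by positivity)]
  exact hm.le

lemma ww_neg_bd (hp : ‖p‖ < 1) (hp0 : p ≠ 0) {x : ℂ} (hx0 : x ≠ 0) {b : ℂ} (hb : ‖b‖ ≤ ‖p‖)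
    (m : ℕ) : ‖ww p x b (-(m : ℤ))‖ ≤ VV p x m * ‖ww p x b 0‖ := by
  induction m with
  | zero => simp [VV]
  | succ m ih =>
    have e : VV p x (m + 1) = VV p x m * ((‖p‖ ^ (m + 1) + ‖p‖) / (‖1 + p ^ (m + 1)‖ * ‖x‖)) := by
      rw [VV, Finset.prod_range_succ, ← VV]
    have h := ww_step hp hp0 hx0 b (-((m + 1 : ℕ) : ℤ))
    rw [show -((m + 1 : ℕ) : ℤ) + 1 = -(m : ℤ) by push_cast; ring, zpow_neg, zpow_natCast] at h
    have h3 := pow_ne_neg_one hp (m + 1)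
    have hpm : p ^ (m + 1) ≠ 0 := pow_ne_zero _ hp0
    have h_alt : ww p x b (-((m + 1 : ℕ) : ℤ)) =
        (p ^ (m + 1) - b) / ((1 + p ^ (m + 1)) * x) * ww p x b (-(m : ℤ)) := by
      generalize p ^ (m + 1) = P at *
      field_simp at h ⊢
      linear_combination h
    rw [h_alt, e, norm_mul, norm_div, norm_mul, mul_comm (VV p x m), mul_assoc]
    gcongr
    refine (norm_sub_le _ _).trans ?_
    rw [norm_pow]
    gcongr

noncomputable def KK (p : ℂ) : ℝ :=
  Real.exp (1 / (1 - ‖p‖)) * (Real.exp (1 / (1 - ‖p‖)) / ‖qPochInf (-1) p‖)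

lemma ww_bd_nat (hp : ‖p‖ < 1) (x : ℂ) {b : ℂ} (hb : ‖b‖ ≤ ‖p‖) (n : ℕ) :
    ‖ww p x b (n : ℤ)‖ ≤ KK p * ‖x‖ ^ n := by
  rw [ww, norm_mul, zpow_natCast, zpow_natCast, norm_pow]
  gcongr
  exact quot_bd hp _ ((norm_mul_pow_le hp _ _).trans (hb.trans hp.le)) n

lemma ww_bd_neg (hp : ‖p‖ < 1) (hp0 : p ≠ 0) {x : ℂ} (hx0 : x ≠ 0) {b : ℂ} (hb : ‖b‖ ≤ ‖p‖)
    (m : ℕ) : ‖ww p x b (-((m : ℤ) + 1))‖ ≤ VV p x (m + 1) * KK p := by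
  have h := ww_neg_bd hp hp0 hx0 hb (m + 1)
  have h0 := ww_bd_nat hp x hb 0
  push_cast at h h0
  rw [pow_zero, mul_one] at h0
  refine h.trans ?_
  have : 0 ≤ VV p x (m + 1) := Finset.prod_nonneg fun j _ => by positivity
  gcongr

noncomputable def gg (p x b : ℂ) : ℂ :=
  ∑' n : ℕ, ww p x b (n : ℤ) + ∑' m : ℕ, ww p x b (-((m : ℤ) + 1))


lemma sum_nat_bd (hp : ‖p‖ < 1) (hp0 : p ≠ 0) {x : ℂ} (hx : ‖x‖ < 1) (hpx : ‖p‖ < ‖x‖)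
    : Summable fun n : ℕ => KK p * ‖x‖ ^ n :=
  (summable_geometric_of_lt_one (norm_nonneg _) hx).mul_left _

lemma sum_neg_bd (hp : ‖p‖ < 1) (hp0 : p ≠ 0) {x : ℂ} (hx : ‖x‖ < 1) (hpx : ‖p‖ < ‖x‖)
    : Summable fun m : ℕ => VV p x (m + 1) * KK p :=
  ((summable_nat_add_iff 1).2 (VV_summable hp hpx)).mul_right _

lemma gg_hasSum (hp : ‖p‖ < 1) (hp0 : p ≠ 0) {x : ℂ} (hx : ‖x‖ < 1) (hpx : ‖p‖ < ‖x‖)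
    {b : ℂ} (hb : ‖b‖ ≤ ‖p‖) : HasSum (ww p x b) (gg p x b) := by
  have hx0 : x ≠ 0 := norm_pos_iff.1 ((norm_nonneg _).trans_lt hpx)
  exact HasSum.of_nat_of_neg_add_one
    ((sum_nat_bd hp hp0 hx hpx).of_norm_bounded (ww_bd_nat hp x hb)).hasSum
    ((sum_neg_bd hp hp0 hx hpx).of_norm_bounded (ww_bd_neg hp hp0 hx0 hb)).hasSum

lemma gg_step (hp : ‖p‖ < 1) (hp0 : p ≠ 0) {x : ℂ} (hx : ‖x‖ < 1) (hpx : ‖p‖ < ‖x‖)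
    {b : ℂ} (hb : ‖b‖ ≤ ‖p‖) : gg p x b * (1 + b / x) = (1 + b) * gg p x (b * p) := by
  have hx0 : x ≠ 0 := norm_pos_iff.1 ((norm_nonneg _).trans_lt hpx)
  have hbp : ‖b * p‖ ≤ ‖p‖ := by
    have := norm_mul_pow_le hp b 1
    rw [pow_one] at this
    linarith
  have s1 := gg_hasSum hp hp0 hx hpx hb
  have s2 := gg_hasSum hp hp0 hx hpx hbp
  have a1 := s1.sub (s2.mul_left (1 + b))
  have a2 := ((Equiv.addRight (1 : ℤ)).hasSum_iff.2 s1).mul_left (-(b / x))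
  have e : gg p x b - (1 + b) * gg p x (b * p) = -(b / x) * gg p x b := by
    refine a1.unique (hasSum_fc (fun n => ?_) a2)
    exact ww_eq hp hp0 hx0 b n
  linear_combination e

lemma ww_lim (hp : ‖p‖ < 1) (hp0 : p ≠ 0) {x : ℂ} (hx : ‖x‖ < 1) (hpx : ‖p‖ < ‖x‖)
    {b : ℂ} (n : ℤ) :
    Tendsto (fun k : ℕ => ww p x (b * p ^ k) n) atTop (𝓝 (ww p x 0 n)) := by
  have h := qp_tendsto_one hp (u := fun k : ℕ => b * p ^ k * p ^ n)
    (by simpa using (tendsto_mul_pow_zero hp b).mul_const (p ^ n))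
  have h0 : qPochInf (0 * p ^ n) p = 1 := by simp [qPochInf]
  simp only [ww, h0]
  exact (h.div_const _).mul_const _

lemma gg_lim (hp : ‖p‖ < 1) (hp0 : p ≠ 0) {x : ℂ} (hx : ‖x‖ < 1) (hpx : ‖p‖ < ‖x‖)
    {b : ℂ} (hb : ‖b‖ ≤ ‖p‖) :
    Tendsto (fun k : ℕ => gg p x (b * p ^ k)) atTop (𝓝 (gg p x 0)) := by
  have hx0 : x ≠ 0 := norm_pos_iff.1 ((norm_nonneg _).trans_lt hpx)
  refine Tendsto.add ?_ ?_
  · exact tendsto_tsum_of_dominated_convergence (sum_nat_bd hp hp0 hx hpx)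
      (fun n => ww_lim hp hp0 hx hpx _)
      (Eventually.of_forall fun k => ww_bd_nat hp x ((norm_mul_pow_le hp b k).trans hb))
  · exact tendsto_tsum_of_dominated_convergence (sum_neg_bd hp hp0 hx hpx)
      (fun n => ww_lim hp hp0 hx hpx _)
      (Eventually.of_forall fun k => ww_bd_neg hp hp0 hx0 ((norm_mul_pow_le hp b k).trans hb))

lemma gg_prod (hp : ‖p‖ < 1) (hp0 : p ≠ 0) {x : ℂ} (hx : ‖x‖ < 1) (hpx : ‖p‖ < ‖x‖)
    {b : ℂ} (hb : ‖b‖ ≤ ‖p‖) :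
    gg p x b * qPochInf (-b / x) p = qPochInf (-b) p * gg p x 0 := by
  have iter : ∀ k : ℕ, gg p x b * qPoch (-b / x) p k = qPoch (-b) p k * gg p x (b * p ^ k) := by
    intro k
    induction k with
    | zero => simp [qPoch]
    | succ k ih =>
      have h := gg_step hp hp0 hx hpx ((norm_mul_pow_le hp b k).trans hb)
      have e1 : qPoch (-b) p (k + 1) = qPoch (-b) p k * (1 + b * p ^ k) := by
        rw [qPoch, Finset.prod_range_succ, ← qPoch]; ring
      have e2 : qPoch (-b / x) p (k + 1) = qPoch (-b / x) p k * (1 + b * p ^ k / x) := by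
        rw [qPoch, Finset.prod_range_succ, ← qPoch]; ring
      rw [show b * p ^ k * p = b * p ^ (k + 1) by ring] at h
      rw [e1, e2]
      linear_combination (1 + b * p ^ k / x) * ih + qPoch (-b) p k * h
  refine tendsto_nhds_unique ((qp_tendsto_poch hp (-b / x)).const_mul (gg p x b)) ?_
  simp only [iter]
  exact (qp_tendsto_poch hp (-b)).mul (gg_lim hp hp0 hx hpx hb)

lemma gg_p (hp : ‖p‖ < 1) (hp0 : p ≠ 0) {x : ℂ} (hx : ‖x‖ < 1) (hpx : ‖p‖ < ‖x‖)
    : gg p x p = ∑' n : ℕ, cc p n * x ^ n := by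
  have e1 : ∀ n : ℕ, ww p x p (n : ℤ) = cc p n * x ^ n := fun n => by
    rw [ww, cc, zpow_natCast, zpow_natCast, ← pow_succ']
  have e2 : ∀ m : ℕ, ww p x p (-((m : ℤ) + 1)) = 0 := fun m => by
    have h : qPochInf (p * p ^ (-((m : ℤ) + 1))) p = 0 := by
      rw [qp_split hp _ (m + 1)]
      have : p * p ^ (-((m : ℤ) + 1)) * p ^ m = 1 := by
        rw [← zpow_natCast p m, ← zpow_one_add₀ hp0, ← zpow_add₀ hp0]
        simp
      rw [qPoch, Finset.prod_range_succ, this]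
      simp
    rw [ww, h]; simp
  simp only [gg, e1, e2, tsum_zero, add_zero]

lemma main_two {q : ℂ} (hq : ‖q‖ < 1) :
    (1 - 2 * q * LL (q ^ 2) q) * (qPochInf (-q) (q ^ 2) * qPochInf (-q ^ 2) (q ^ 2)) ^ 2 =
      (qPochInf q (q ^ 2) * qPochInf (q ^ 2) (q ^ 2)) ^ 2 := by
  by_cases hq0 : q = 0
  · subst hq0
    simp [qPochInf]
  set p := q ^ 2 with hpq
  have hp0 : p ≠ 0 := pow_ne_zero _ hq0
  have hqpos : 0 < ‖q‖ := norm_pos_iff.2 hq0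
  have hpx : ‖p‖ < ‖-q‖ := by
    rw [hpq, norm_pow, norm_neg]; nlinarith
  have hx : ‖-q‖ < 1 := by simpa using hq
  have hp : ‖p‖ < 1 := hpx.trans hx
  have g1 := gg_prod hp hp0 hx hpx (b := p) le_rfl
  have g2 := gg_prod hp hp0 hx hpx (b := -p) (by simp)
  rw [show -p / -q = q by rw [hpq]; field_simp] at g1
  rw [neg_neg, show p / -q = -q by rw [hpq]; field_simp] at g2
  have g3 := qbinom hp hx
  rw [← gg_p hp hp0 hx hpx, neg_neg] at g3
  have c0 : cc p 0 * (2 * qPochInf (-p) p) = qPochInf p p := by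
    have h := qp_step hp (-1)
    have h_alt := qp_ne_neg_one hp
    have e : (2 : ℂ) * qPochInf (-p) p = qPochInf (-1) p := by
      rw [h]; norm_num
    rw [e, cc]
    simp only [zero_add, pow_one, pow_zero]
    field_simp
  have hpn : ‖-p‖ < 1 := by simpa using hp
  have n1 := qp_ne_of_lt hp (-p) hpn
  have n2 := qp_ne_of_lt hp (-q) hx
  have n3 := qp_ne_of_lt hp q hq
  have gl : gg p (-q) (-p) = 1 / 2 - q * LL p q := by
    have w : ∀ n : ℤ, ww p (-q) (-p) n = (-q) ^ n / (1 + p ^ n) := by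
      intro n
      have e := qp_step hp (-p ^ n)
      have h1 := zpow_ne_neg_one hp n
      have h2 := zneg_ne hp hp0 n
      rw [show -p ^ n * p = -p * p ^ n by ring, sub_neg_eq_add] at e
      have h3 : qPochInf (-p * p ^ n) p ≠ 0 := by
        intro h_alt; rw [h_alt, mul_zero] at e; exact h2 e
      rw [ww, e]
      generalize qPochInf (-p * p ^ n) p = X at h3
      field_simp
    have s1 : Summable fun n : ℕ => ww p (-q) (-p) (n : ℤ) :=
      (sum_nat_bd hp hp0 hx hpx).of_norm_bounded (ww_bd_nat hp _ (by simp))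
    have e1 := s1.tsum_eq_zero_add
    have t1 : ∀ n : ℕ, ww p (-q) (-p) ((n + 1 : ℕ) : ℤ) =
        -q / 2 * (2 * (-1) ^ n / (1 + p ^ (n + 1)) * q ^ n) := by
      intro n
      rw [w, zpow_natCast, zpow_natCast, pow_succ (-q), neg_pow q]
      have := pow_ne_neg_one hp (n + 1)
      field_simp
    have t2 : ∀ n : ℕ, ww p (-q) (-p) (-((n : ℤ) + 1)) =
        -q / 2 * (2 * (-1) ^ n / (1 + p ^ (n + 1)) * q ^ n) := by
      intro n
      rw [← t1, w, w]
      have hc : ((n : ℤ) + 1) = ((n + 1 : ℕ) : ℤ) := by push_cast; ring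
      rw [hc, zpow_neg, zpow_neg, zpow_natCast, zpow_natCast]
      have h1 := pow_ne_neg_one hp (n + 1)
      have h2 : p ^ (n + 1) = ((-q) ^ (n + 1)) ^ 2 := by
        rw [hpq, ← pow_mul, ← pow_mul, mul_comm (n + 1) 2, pow_mul (-q), neg_sq, pow_mul]
      have h3 : (-q) ^ (n + 1) ≠ 0 := pow_ne_zero _ (neg_ne_zero.2 hq0)
      rw [h2] at h1 ⊢
      generalize (-q) ^ (n + 1) = Q at *
      have h4 : 1 + (Q ^ 2)⁻¹ ≠ 0 := by
        intro h
        apply h1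
        field_simp at h
        linear_combination h
      rw [div_eq_div_iff h4 h1]
      field_simp
      ring
    rw [gg, e1]
    simp only [t1, t2]
    rw [tsum_mul_left, w]
    simp only [Nat.cast_zero, zpow_zero]
    rw [LL]
    ring
  have fin : gg p (-q) (-p) * 2 * (qPochInf (-q) p * qPochInf (-p) p) ^ 2 =
      (qPochInf q p * qPochInf p p) ^ 2 := by
    linear_combination 2 * qPochInf (-q) p * qPochInf (-p) p ^ 2 * g2
      - 2 * qPochInf (-q) p * qPochInf p p * qPochInf (-p) p * g1
      + 2 * qPochInf q p * qPochInf p p * qPochInf (-p) p * g3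
      + qPochInf q p ^ 2 * qPochInf p p * c0
  rw [← fin, gl]
  ring

end parttwo

lemma stmt_euler {q : ℂ} (hq : ‖q‖ < 1) (s : ℂ) :
    qPochInf (s * q) q = qPochInf (s * q) (q ^ 2) * qPochInf (s * q ^ 2) (q ^ 2) := by
  have hp : ‖q ^ 2‖ < 1 := by rw [norm_pow]; exact pow_lt_one₀ (norm_nonneg _) hq two_ne_zero
  have h1 := qp_mult hp (s * q)
  have h2 := qp_mult hp (s * q ^ 2)
  have e1 : (fun k : ℕ => 1 - s * q * (q ^ 2) ^ k) = fun k : ℕ => 1 - s * q * q ^ (2 * k) := by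
    funext k; rw [pow_mul]
  have e2 : (fun k : ℕ => 1 - s * q ^ 2 * (q ^ 2) ^ k) =
      fun k : ℕ => 1 - s * q * q ^ (2 * k + 1) := by
    funext k; rw [pow_succ q (2 * k), pow_mul]; ring
  rw [qPochInf, qPochInf, qPochInf, e1, e2]
  rw [e1] at h1
  rw [e2] at h2
  exact (tprod_even_mul_odd (f := fun j : ℕ => 1 - s * q * q ^ j) h1 h2).symm

lemma stmt_mul {q : ℂ} (hq : ‖q‖ < 1) :
    qPochInf q q * qPochInf (-q) q = qPochInf (q ^ 2) (q ^ 2) := by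
  have h := (qp_mult hq q).tprod_mul (qp_mult hq (-q))
  rw [qPochInf, qPochInf, qPochInf, ← h]
  exact tprod_congr fun j => by rw [← pow_mul, mul_comm 2 j, pow_mul]; ring

lemma phi_eq {q : ℂ} (hq : ‖q‖ < 1) : mockPhi (-q) = 1 - q * MM (q ^ 2) q := by
  have hp : ‖q ^ 2‖ < 1 := by rw [norm_pow]; exact pow_lt_one₀ (norm_nonneg _) hq two_ne_zero
  obtain ⟨K, hK⟩ := MM_coef_bd hp
  have s := (bdd_series hK hq).1
  have t : ∀ m : ℕ, (-q) ^ ((m + 1) ^ 2) / qPoch (-(-q) ^ 2) ((-q) ^ 2) (m + 1) =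
      -q * ((-1) ^ m * (q ^ 2) ^ (m * (m + 1) / 2) / qPoch (-q ^ 2) (q ^ 2) (m + 1) * q ^ m) := by
    intro m
    have h1 : (q ^ 2) ^ (m * (m + 1) / 2) = q ^ (m * (m + 1)) := by
      rw [← pow_mul, Nat.mul_div_cancel' (Nat.even_mul_succ_self m).two_dvd]
    have h2 : (-q) ^ ((m + 1) ^ 2) = -((-1) ^ m * q ^ ((m + 1) ^ 2)) := by
      rw [neg_pow, show (m + 1) ^ 2 = m * (m + 1) + m + 1 by ring, pow_succ (-1 : ℂ),
        pow_add (-1 : ℂ), (Nat.even_mul_succ_self m).neg_one_pow]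
      ring
    rw [neg_sq, h1, h2]
    ring
  have s_alt : Summable fun n : ℕ => (-q) ^ (n ^ 2) / qPoch (-(-q) ^ 2) ((-q) ^ 2) n := by
    rw [← summable_nat_add_iff 1]
    simp only [t]
    exact s.mul_left _
  rw [mockPhi, s_alt.tsum_eq_zero_add]
  simp only [t]
  rw [tsum_mul_left, MM]
  simp [qPoch]
  ring

lemma Pev_eq (q : ℂ) : Pev q = (1 + q) * (q * HH (q ^ 2) q) := by
  have e : ∀ n : ℕ, rr (q ^ 2) n * qPochInf (-q * (q ^ 2) ^ (n + 1)) (q ^ 2) * (q ^ 2) ^ n =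
      qPochInf (-q ^ (2 * n + 2)) (q ^ 2) * qPochInf (-q ^ (2 * n + 3)) (q ^ 2) *
      q ^ (2 * n) / qPochInf (q ^ (2 * n + 2)) (q ^ 2) := by
    intro n
    rw [rr, show (q ^ 2) ^ (n + 1) = q ^ (2 * n + 2) by rw [← pow_mul]; ring_nf,
      show -q * q ^ (2 * n + 2) = -q ^ (2 * n + 3) by ring, ← pow_mul]
    ring
  have e1 : q * HH (q ^ 2) q = ∑' n : ℕ, qPochInf (-q ^ (2 * n + 2)) (q ^ 2) *
      qPochInf (-q ^ (2 * n + 3)) (q ^ 2) * q ^ (2 * n + 1) / qPochInf (q ^ (2 * n + 2)) (q ^ 2) := by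
    rw [HH, ← tsum_mul_left]
    refine tsum_congr fun n => ?_
    rw [e]; ring
  have e2 : q * (q * HH (q ^ 2) q) = ∑' n : ℕ, qPochInf (-q ^ (2 * (n + 1))) (q ^ 2) *
      qPochInf (-q ^ (2 * (n + 1) + 1)) (q ^ 2) *
      q ^ (2 * (n + 1)) / qPochInf (q ^ (2 * (n + 1))) (q ^ 2) := by
    rw [HH, ← tsum_mul_left, ← tsum_mul_left]
    refine tsum_congr fun n => ?_
    rw [e, show 2 * (n + 1) = 2 * n + 2 by ring]; ring
  rw [Pev, ← e1, ← e2]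
  ring

/-- For |q|<1,
`P_ev(q) = ((1+q)/(2(q;q)_∞))(1 - (q;q)_∞²/(-q;q)_∞²) + (1+q)(φ(-q) - 1)`. -/
theorem stmt_17 (q : ℂ) (hq : ‖q‖ < 1) :
    Pev q = (1 + q) / (2 * qPochInf q q) * (1 - qPochInf q q ^ 2 / qPochInf (-q) q ^ 2)
      + (1 + q) * (mockPhi (-q) - 1) := by
  have hp : ‖q ^ 2‖ < 1 := by rw [norm_pow]; exact pow_lt_one₀ (norm_nonneg _) hq two_ne_zero
  have hqn : ‖-q‖ < 1 := by simpa using hq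
  have hpn : ‖-q ^ 2‖ < 1 := by simpa using hp
  have m1 := main_one hp hq
  have m2 := main_two hq
  have u1 := stmt_euler hq 1
  have u2 := stmt_euler hq (-1)
  have u3 := stmt_mul hq
  rw [one_mul, one_mul] at u1
  rw [neg_one_mul, neg_one_mul] at u2
  have n1 := qp_ne_of_lt hq q hq
  have n2 := qp_ne_of_lt hq (-q) hqn
  have n3 := qp_ne_of_lt hp (q ^ 2) hp
  rw [← u1, ← u2] at m2
  have k : rr (q ^ 2) 0 * qPochInf (-q) (q ^ 2) = 1 / qPochInf q q := by
    rw [rr]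
    simp only [zero_add, pow_one]
    rw [div_mul_eq_mul_div, mul_comm, ← u2, div_eq_div_iff n3 n1, one_mul, ← u3, mul_comm]
  have m3 : qPochInf q q ^ 2 / qPochInf (-q) q ^ 2 = 1 - 2 * q * LL (q ^ 2) q := by
    rw [← m2]
    field_simp
  rw [Pev_eq, m1, k, phi_eq hq, m3]
  field_simp
  ring
end
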